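/- arXiv:2311.03769 — 2 statements merged into one kernel-verified Lean document; each statement's English description precedes it below -/
import Mathlib

section
/- (Exact U-statistic decomposition of the empirical importance score, identity (13) in the proof of Theorem 1.) Let n ≥ 3 and let c₁,…,c_n and x₁,…,x_n be real numbers. Define S = n⁻¹ Σ_{i=1}^n ( n⁻¹ Σ_{j=1}^n c_j·1_{x_j<x_i} )², U₁ = (2/(n(n−1))) Σ_{1≤i<j≤n} (1/2)( c_i²·1_{x_i<x_j} + c_j²·1_{x_j<x_i} ), and U₂ = (6/(n(n−1)(n−2))) Σ_{1≤i<j<ℓ≤n} (1/3)( c_i c_j·1_{x_i<x_ℓ}·1_{x_j<x_ℓ} + c_j c_ℓ·1_{x_j<x_i}·1_{x_ℓ<x_i} + c_ℓ c_i·1_{x_ℓ<x_j}·1_{x_i<x_j} ). Then S = ((n−1)(n−2)/n²)·( U₁/(n−2) + U₂ ). -/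
open Finset

section Sums

variable {ι : Type*} [Fintype ι] [LinearOrder ι]

/-- A double sum vanishing on the diagonal, written as a sum over increasing pairs. -/
theorem sum_sum_eq_sum_lt {R : Type*} [AddCommMonoid R] (f : ι → ι → R)
    (hf : ∀ i, f i i = 0) :
    ∑ i, ∑ j, f i j = ∑ i, ∑ j, if i < j then f i j + f j i else 0 := by
  have split : ∀ i j, f i j = (if i < j then f i j else 0) + if j < i then f i j else 0 := by
    intro i j
    rcases lt_trichotomy i j with h | rfl | h
    · simp [h, h.not_gt]
    · simp [hf]
    · simp [h, h.not_gt]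
  calc ∑ i, ∑ j, f i j
      = ∑ i, ∑ j, (if i < j then f i j else 0)
          + ∑ i, ∑ j, (if j < i then f i j else 0) := by
        simp_rw [← sum_add_distrib, ← split]
    _ = ∑ i, ∑ j, (if i < j then f i j else 0)
          + ∑ i, ∑ j, (if i < j then f j i else 0) := by
        rw [sum_comm (f := fun i j => if j < i then f i j else 0)]
    _ = _ := by
        simp_rw [← sum_add_distrib]
        refine sum_congr rfl fun i _ => sum_congr rfl fun j _ => ?_
        split_ifs <;> simp

/-- The square of a sum as the diagonal part plus twice the sum over increasing pairs. -/
theorem sq_sum_eq_sum_sq_add_two_mul_sum_lt {R : Type*} [CommRing R] (a : ι → R) :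
    (∑ j, a j) ^ 2 = ∑ j, a j ^ 2 + 2 * ∑ j, ∑ k, if j < k then a j * a k else 0 := by
  have h := sum_sum_eq_sum_lt (fun j k => if j = k then 0 else a j * a k) (by simp)
  have diag : ∑ j, a j ^ 2 = ∑ j, ∑ k, if j = k then a j * a k else 0 := by
    simp [sq]
  have off : 2 * ∑ j, ∑ k, (if j < k then a j * a k else 0)
      = ∑ j, ∑ k, if j = k then 0 else a j * a k := by
    rw [h]
    simp_rw [mul_sum]
    refine sum_congr rfl fun j _ => sum_congr rfl fun k _ => ?_
    by_cases hjk : j < k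
    · simp only [hjk, hjk.ne, hjk.ne', if_true, if_false]
      ring
    · simp [hjk]
  rw [diag, off, sq, sum_mul_sum]
  simp_rw [← sum_add_distrib]
  refine sum_congr rfl fun j _ => sum_congr rfl fun k _ => ?_
  split_ifs <;> simp

/-- A sum over an index and an increasing pair avoiding it, written as a sum over increasing
triples. -/
theorem sum_sum_lt_eq_sum_lt_lt {R : Type*} [AddCommMonoid R] (f : ι → ι → ι → R)
    (hl : ∀ i k, f i i k = 0) (hr : ∀ i j, f i j i = 0) :
    ∑ i, ∑ j, ∑ k, (if j < k then f i j k else 0)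
      = ∑ i, ∑ j, ∑ k, if i < j ∧ j < k then f i j k + f j i k + f k i j else 0 := by
  have split : ∀ i j k, (if j < k then f i j k else 0)
      = (if i < j ∧ j < k then f i j k else 0) + (if j < i ∧ i < k then f i j k else 0)
        + if j < k ∧ k < i then f i j k else 0 := by
    intro i j k
    by_cases hjk : j < k
    · rcases lt_trichotomy i j with h | rfl | h
      · simp [hjk, h, h.not_gt, (h.trans hjk).not_gt]
      · simp [hl]
      · rcases lt_trichotomy i k with h' | rfl | h'
        · simp [hjk, h, h', h.not_gt, h'.not_gt]
        · simp [hr]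
        · simp [hjk, h, h', h.not_gt, h'.not_gt]
    · have h₁ : ¬(j < i ∧ i < k) := fun h => hjk (h.1.trans h.2)
      simp [hjk, h₁]
  have middle : ∑ i, ∑ j, ∑ k, (if j < i ∧ i < k then f i j k else 0)
      = ∑ i, ∑ j, ∑ k, if i < j ∧ j < k then f j i k else 0 := sum_comm
  have last : ∑ i, ∑ j, ∑ k, (if j < k ∧ k < i then f i j k else 0)
      = ∑ i, ∑ j, ∑ k, if i < j ∧ j < k then f k i j else 0 := by
    rw [sum_comm]
    exact sum_congr rfl fun i _ => sum_comm
  simp_rw [split, sum_add_distrib]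
  rw [middle, last]
  simp_rw [← sum_add_distrib]
  refine sum_congr rfl fun i _ => sum_congr rfl fun j _ => sum_congr rfl fun k _ => ?_
  split_ifs <;> simp

end Sums

/-- Decomposition of a sum of squared column sums of a matrix with zero diagonal. -/
theorem sum_sq_sum_eq_sum_lt_add_sum_lt_lt {ι R : Type*} [Fintype ι] [LinearOrder ι]
    [CommRing R] (g : ι → ι → R) (hg : ∀ i, g i i = 0) :
    ∑ i, (∑ j, g j i) ^ 2
      = ∑ i, ∑ j, (if i < j then g i j ^ 2 + g j i ^ 2 else 0)
        + 2 * ∑ i, ∑ j, ∑ l, (if i < j ∧ j < l then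
            g i l * g j l + g j i * g l i + g l j * g i j else 0) := by
  simp_rw [sq_sum_eq_sum_sq_add_two_mul_sum_lt, sum_add_distrib, ← mul_sum]
  rw [sum_sum_lt_eq_sum_lt_lt (fun i j k => g j i * g k i) (by simp [hg]) (by simp [hg]),
    sum_sum_eq_sum_lt (fun i j => g j i ^ 2) (by simp [hg])]
  congr 1
  · simp_rw [add_comm]
  · congr 1
    refine sum_congr rfl fun i _ => sum_congr rfl fun j _ => sum_congr rfl fun l _ => ?_
    split_ifs
    · ring
    · rfl

/-- Exact U-statistic decomposition of the empirical importance score: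
with S = n⁻¹ Σᵢ (n⁻¹ Σⱼ cⱼ 1_{xⱼ<xᵢ})², U₁ the order-2 U-statistic and U₂ the order-3
U-statistic with the displayed kernels, S = ((n−1)(n−2)/n²)(U₁/(n−2) + U₂). -/
theorem ustatistic_decomposition (n : ℕ) (hn : 3 ≤ n) (c x : Fin n → ℝ) :
    (n : ℝ)⁻¹ * ∑ i : Fin n,
        ((n : ℝ)⁻¹ * ∑ j : Fin n, c j * (if x j < x i then (1 : ℝ) else 0)) ^ 2
      = (((n : ℝ) - 1) * ((n : ℝ) - 2) / (n : ℝ) ^ 2) *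
          ((2 / ((n : ℝ) * ((n : ℝ) - 1)) *
              ∑ i : Fin n, ∑ j : Fin n,
                (if i < j then
                  (1 / 2) * ((c i) ^ 2 * (if x i < x j then (1 : ℝ) else 0)
                    + (c j) ^ 2 * (if x j < x i then (1 : ℝ) else 0))
                 else 0)) / ((n : ℝ) - 2)
            + 6 / ((n : ℝ) * ((n : ℝ) - 1) * ((n : ℝ) - 2)) *
                ∑ i : Fin n, ∑ j : Fin n, ∑ l : Fin n,
                  (if i < j ∧ j < l then
                    (1 / 3) * (c i * c j * (if x i < x l then (1 : ℝ) else 0)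
                          * (if x j < x l then (1 : ℝ) else 0)
                      + c j * c l * (if x j < x i then (1 : ℝ) else 0)
                          * (if x l < x i then (1 : ℝ) else 0)
                      + c l * c i * (if x l < x j then (1 : ℝ) else 0)
                          * (if x i < x j then (1 : ℝ) else 0))
                   else 0)) := by
  have hn' : (3 : ℝ) ≤ n := by exact_mod_cast hn
  have h₀ : (n : ℝ) ≠ 0 := by linarith
  have h₁ : (n : ℝ) - 1 ≠ 0 := by linarith
  have h₂ : (n : ℝ) - 2 ≠ 0 := by linarith
  have key := sum_sq_sum_eq_sum_lt_add_sum_lt_lt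
    (fun i j => c i * (if x i < x j then (1 : ℝ) else 0)) (by simp)
  have pairs : ∀ i j : Fin n,
      (if i < j then
        (1 / 2) * ((c i) ^ 2 * (if x i < x j then (1 : ℝ) else 0)
          + (c j) ^ 2 * (if x j < x i then (1 : ℝ) else 0))
       else 0)
      = (1 / 2) * (if i < j then (c i * (if x i < x j then (1 : ℝ) else 0)) ^ 2
          + (c j * (if x j < x i then (1 : ℝ) else 0)) ^ 2 else 0) := by
    intro i j
    simp only [mul_pow, ite_pow, one_pow, zero_pow two_ne_zero, mul_ite, mul_zero]
  have triples : ∀ i j l : Fin n,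
      (if i < j ∧ j < l then
        (1 / 3) * (c i * c j * (if x i < x l then (1 : ℝ) else 0)
              * (if x j < x l then (1 : ℝ) else 0)
          + c j * c l * (if x j < x i then (1 : ℝ) else 0)
              * (if x l < x i then (1 : ℝ) else 0)
          + c l * c i * (if x l < x j then (1 : ℝ) else 0)
              * (if x i < x j then (1 : ℝ) else 0))
       else 0)
      = (1 / 3) * (if i < j ∧ j < l then
          (c i * (if x i < x l then (1 : ℝ) else 0)) * (c j * (if x j < x l then (1 : ℝ) else 0))
          + (c j * (if x j < x i then (1 : ℝ) else 0)) * (c l * (if x l < x i then (1 : ℝ) else 0))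
          + (c l * (if x l < x j then (1 : ℝ) else 0)) * (c i * (if x i < x j then (1 : ℝ) else 0))
          else 0) := by
    intro i j l
    by_cases h : i < j ∧ j < l
    · rw [if_pos h, if_pos h]
      ring
    · rw [if_neg h, if_neg h, mul_zero]
  simp_rw [pairs, triples, mul_pow, ← mul_sum]
  simp only [mul_pow] at key
  rw [key]
  field_simp
  ring
end

section
/- (Hoeffding block representation of an order-3 U-statistic.) Let n ≥ 3, m = ⌊n/3⌋, let α be any type, let φ : α × α × α → ℝ be symmetric (invariant under all permutations of its three arguments), and let z₁,…,z_n ∈ α. Then (1/C(n,3)) Σ_{1≤i<j<ℓ≤n} φ(z_i, z_j, z_ℓ) = (1/n!) Σ_{σ ∈ S_n} m⁻¹ Σ_{b=1}^m φ(z_{σ(3b−2)}, z_{σ(3b−1)}, z_{σ(3b)}), where C(n,3) = n(n−1)(n−2)/6 is the binomial coefficient and the outer sum ranges over all n! permutations σ of {1,…,n}. -/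
open Finset

/-- Averaging a function over the orbit map of a transitive action of a finite group
is averaging it over the space acted on. -/
theorem card_mul_sum_smul_eq_card_mul_sum {G X : Type*} [Group G] [Fintype G] [Fintype X]
    [MulAction G X] [MulAction.IsPretransitive G X] (f : X → ℝ) (x : X) :
    (Fintype.card X : ℝ) * ∑ g : G, f (g • x) = Fintype.card G * ∑ y, f y := by
  have hconst (y : X) : ∑ g : G, f (g • y) = ∑ g : G, f (g • x) := by
    obtain ⟨h, rfl⟩ := MulAction.exists_smul_eq G x y
    simpa [mul_smul] using Equiv.sum_comp (Equiv.mulRight h) fun g : G => f (g • x)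
  calc (Fintype.card X : ℝ) * ∑ g : G, f (g • x)
      = ∑ y : X, ∑ g : G, f (g • y) := by simp [hconst]
    _ = ∑ g : G, ∑ y : X, f (g • y) := sum_comm
    _ = ∑ _g : G, ∑ y, f y := sum_congr rfl fun g _ => Equiv.sum_comp (MulAction.toPerm g) f
    _ = Fintype.card G * ∑ y, f y := by simp

/-- The embedding of `Fin 3` with three prescribed distinct values. -/
def embeddingOfDistinct {ι : Type*} (i j l : ι) (h : i ≠ j ∧ i ≠ l ∧ j ≠ l) : Fin 3 ↪ ι where
  toFun := ![i, j, l]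
  inj' a b hab := by
    obtain ⟨h₁, h₂, h₃⟩ := h
    fin_cases a <;> fin_cases b <;> simp_all

theorem sum_embedding_fin_three {ι : Type*} [Fintype ι] [DecidableEq ι] (f : ι → ι → ι → ℝ) :
    ∑ e : Fin 3 ↪ ι, f (e 0) (e 1) (e 2) =
      ∑ i, ∑ j, ∑ l, if i ≠ j ∧ i ≠ l ∧ j ≠ l then f i j l else 0 := by
  simp_rw [← Fintype.sum_prod_type']
  rw [← sum_filter]
  refine sum_bij' (fun e _ => (e 0, e 1, e 2))
    (fun p hp => embeddingOfDistinct p.1 p.2.1 p.2.2 (mem_filter.1 hp).2) ?_ ?_ ?_ ?_ ?_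
  · intro e _
    simp
  · simp
  · intro e _
    ext a
    fin_cases a <;> rfl
  · intro p _
    rfl
  · intro e _
    rfl

/-- A symmetric function summed over ordered triples of distinct indices is six times its sum over
increasing triples. -/
theorem sum_distinct_eq_six_mul_sum_lt {ι : Type*} [Fintype ι] [LinearOrder ι]
    (f : ι → ι → ι → ℝ) (h₁ : ∀ i j l, f i j l = f j i l) (h₂ : ∀ i j l, f i j l = f i l j) :
    (∑ i, ∑ j, ∑ l, if i ≠ j ∧ i ≠ l ∧ j ≠ l then f i j l else 0) =
      6 * ∑ i, ∑ j, ∑ l, if i < j ∧ j < l then f i j l else 0 := by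
  set g : ι → ι → ι → ℝ := fun i j l => if i < j ∧ j < l then f i j l else 0 with hg
  have hsplit (i j l : ι) : (if i ≠ j ∧ i ≠ l ∧ j ≠ l then f i j l else 0) =
      g i j l + g i l j + g j i l + g j l i + g l i j + g l j i := by
    have e₁ : f i l j = f i j l := (h₂ i j l).symm
    have e₂ : f j i l = f i j l := (h₁ i j l).symm
    have e₃ : f j l i = f i j l := by rw [h₂, e₂]
    have e₄ : f l i j = f i j l := by rw [h₁, e₁]
    have e₅ : f l j i = f i j l := by rw [h₂, e₄]
    simp only [hg, e₁, e₂, e₃, e₄, e₅]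
    grind
  have swap₁ (k : ι → ι → ι → ℝ) : ∑ i, ∑ j, ∑ l, k j i l = ∑ i, ∑ j, ∑ l, k i j l := sum_comm
  have swap₂ (k : ι → ι → ι → ℝ) : ∑ i, ∑ j, ∑ l, k i l j = ∑ i, ∑ j, ∑ l, k i j l :=
    sum_congr rfl fun _ _ => sum_comm
  have s₃ : ∑ i, ∑ j, ∑ l, g j l i = ∑ i, ∑ j, ∑ l, g i j l := by
    rw [swap₁ fun i j l => g i l j, swap₂]
  have s₄ : ∑ i, ∑ j, ∑ l, g l i j = ∑ i, ∑ j, ∑ l, g i j l := by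
    rw [swap₂ fun i j l => g j i l, swap₁]
  have s₅ : ∑ i, ∑ j, ∑ l, g l j i = ∑ i, ∑ j, ∑ l, g i j l := by
    rw [swap₁ fun i j l => g l i j, s₄]
  simp_rw [hsplit, sum_add_distrib]
  rw [swap₁ g, swap₂ g, s₃, s₄, s₅]
  ring

/-- Hoeffding block representation of an order-3 U-statistic:
for a symmetric kernel φ and points z₁,…,z_n,
(1/C(n,3)) Σ_{i<j<ℓ} φ(zᵢ,zⱼ,z_ℓ)
  = (1/n!) Σ_{σ ∈ Sₙ} m⁻¹ Σ_{b=1}^m φ(z_{σ(3b−2)}, z_{σ(3b−1)}, z_{σ(3b)}),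
where m = ⌊n/3⌋. -/
theorem hoeffding_block_representation {α : Type*} (n m : ℕ) (hn : 3 ≤ n) (hm : m = n / 3)
    (φ : α × α × α → ℝ)
    (hsym1 : ∀ a b c : α, φ (a, b, c) = φ (b, a, c))
    (hsym2 : ∀ a b c : α, φ (a, b, c) = φ (a, c, b))
    (z : Fin n → α) :
    ((n.choose 3 : ℝ))⁻¹ *
        ∑ i : Fin n, ∑ j : Fin n, ∑ l : Fin n,
          (if i < j ∧ j < l then φ (z i, z j, z l) else 0)
      = ((n.factorial : ℝ))⁻¹ *
          ∑ σ : Equiv.Perm (Fin n),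
            (m : ℝ)⁻¹ *
              ∑ b : Fin m,
                φ (z (σ ⟨3 * (b : ℕ), by have := b.isLt; omega⟩),
                   z (σ ⟨3 * (b : ℕ) + 1, by have := b.isLt; omega⟩),
                   z (σ ⟨3 * (b : ℕ) + 2, by have := b.isLt; omega⟩)) := by
  have hm0 : (m : ℝ) ≠ 0 := by
    have : m ≠ 0 := by omega
    exact_mod_cast this
  have hfact : (n.factorial : ℝ) ≠ 0 := by exact_mod_cast n.factorial_ne_zero
  have hchoose : (n.choose 3 : ℝ) ≠ 0 := by exact_mod_cast (Nat.choose_pos hn).ne'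
  set U := ∑ i : Fin n, ∑ j : Fin n, ∑ l : Fin n,
    (if i < j ∧ j < l then φ (z i, z j, z l) else 0) with hU
  have hblock (p q r : Fin n) (h : p ≠ q ∧ p ≠ r ∧ q ≠ r) :
      ∑ σ : Equiv.Perm (Fin n), φ (z (σ p), z (σ q), z (σ r)) =
        n.factorial * ((n.choose 3 : ℝ)⁻¹ * U) := by
    have : MulAction.IsPretransitive (Equiv.Perm (Fin n)) (Fin 3 ↪ Fin n) :=
      Equiv.Perm.isMultiplyPretransitive (Fin n) 3
    have key := card_mul_sum_smul_eq_card_mul_sum (G := Equiv.Perm (Fin n))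
      (fun e : Fin 3 ↪ Fin n => φ (z (e 0), z (e 1), z (e 2))) (embeddingOfDistinct p q r h)
    rw [sum_embedding_fin_three fun i j l => φ (z i, z j, z l),
      sum_distinct_eq_six_mul_sum_lt (fun i j l => φ (z i, z j, z l))
        (fun _ _ _ => hsym1 _ _ _) (fun _ _ _ => hsym2 _ _ _),
      ← hU, Fintype.card_embedding_eq, Fintype.card_perm, Fintype.card_fin, Fintype.card_fin,
      Nat.descFactorial_eq_factorial_mul_choose] at key
    change _ * ∑ σ : Equiv.Perm (Fin n), φ (z (σ p), z (σ q), z (σ r)) = _ at key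
    norm_num [Nat.factorial_succ 2] at key
    field_simp
    linarith
  rw [← mul_sum, sum_comm, sum_congr rfl fun b _ => hblock _ _ _ (by simp [Fin.ext_iff])]
  simp only [sum_const, card_univ, Fintype.card_fin, nsmul_eq_mul]
  field_simp
end
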